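/- arXiv:2209.07892 — 12 statements merged into one kernel-verified Lean document; each statement's English description precedes it below -/
import Mathlib

section
/- Let F be a field with char(F) ≠ 2 and let L₁ = F² with basis {e₁,e₂} and the right Leibniz bracket determined by [e₂,e₂] = e₁ (all other brackets of basis vectors zero). Then a pair of linear maps (d,D) on L₁ is a biderivation of L₁ if and only if there exist a, b, x ∈ F such that, with respect to the basis {e₁,e₂}, d has matrix with rows (2a, b), (0, a) and D has matrix with rows (0, x), (0, a). -/
open Matrix

/-- The bracket of the two-dimensional nilpotent Leibniz algebra `L₁`,
determined by `[e₂,e₂] = e₁` and bilinearity. -/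
def bracketL1 {F : Type*} [Field F] (u v : Fin 2 → F) : Fin 2 → F :=
  ![u 1 * v 1, 0]

theorem biderivations_of_L1_dim2
    (F : Type*) [Field F] (hchar : (2 : F) ≠ 0)
    (d D : (Fin 2 → F) →ₗ[F] (Fin 2 → F)) :
    ((∀ u v, d (bracketL1 u v) = bracketL1 (d u) v + bracketL1 u (d v)) ∧
     (∀ u v, D (bracketL1 u v) = bracketL1 (D u) v - bracketL1 (D v) u) ∧
     (∀ u v, bracketL1 u (d v) = bracketL1 u (D v))) ↔
    ∃ a b x : F,
      LinearMap.toMatrix' d = !![2*a, b; 0, a] ∧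
      LinearMap.toMatrix' D = !![0, x; 0, a] := by
  obtain ⟨M, rfl⟩ := Matrix.toLin'.surjective d
  obtain ⟨N, rfl⟩ := Matrix.toLin'.surjective D
  simp only [LinearMap.toMatrix'_toLin', Matrix.toLin'_apply]
  constructor
  · rintro ⟨hd, hD, hdD⟩
    have hd₂ := hd ![0, 1] ![0, 1]
    have hD₂ := hD ![0, 1] ![0, 1]
    have h₂ := hdD ![0, 1] ![0, 1]
    simp [bracketL1, funext_iff, Fin.forall_fin_two, Matrix.mulVec, dotProduct,
      Fin.sum_univ_two] at hd₂ hD₂ h₂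
    refine ⟨M 1 1, M 0 1, N 0 1, ?_, ?_⟩
    · ext i j
      fin_cases i <;> fin_cases j <;> simp [hd₂, two_mul]
    · ext i j
      fin_cases i <;> fin_cases j <;> simp [hD₂, h₂]
  · rintro ⟨a, b, x, rfl, rfl⟩
    refine ⟨fun u v => ?_, fun u v => ?_, fun u v => ?_⟩ <;> ext i <;> fin_cases i <;>
      simp [bracketL1, Matrix.mulVec, dotProduct, Fin.sum_univ_two] <;> ring
end

section
/- Let F be a field with char(F) ≠ 2 and let L₂ = F² with basis {e₁,e₂} and the right Leibniz bracket determined by [e₁,e₂] = e₁ and [e₂,e₂] = e₁ (all other brackets of basis vectors zero). Then a pair of linear maps (d,D) on L₂ is a biderivation of L₂ if and only if there exist a, x ∈ F such that, with respect to the basis {e₁,e₂}, d has matrix with rows (a, a), (0, 0) and D has matrix with rows (0, x), (0, 0). -/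
open Matrix

/-- Bracket of the two-dimensional solvable Leibniz algebra `L₂`: `[e₁,e₂] = [e₂,e₂] = e₁`. -/
def bracketL2dim2 {F : Type*} [Field F] (u v : Fin 2 → F) : Fin 2 → F :=
  ![u 0 * v 1 + u 1 * v 1, 0]

/-- A linear endomorphism of `F²` acts on coordinates through its matrix. -/
theorem apply_eq_toMatrix'_fin_two {F : Type*} [Field F]
    (T : (Fin 2 → F) →ₗ[F] (Fin 2 → F)) (u : Fin 2 → F) (i : Fin 2) :
    T u i = LinearMap.toMatrix' T i 0 * u 0 + LinearMap.toMatrix' T i 1 * u 1 := by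
  rw [← LinearMap.toMatrix'_mulVec T u, Matrix.mulVec, dotProduct, Fin.sum_univ_two]

theorem biderivations_L2dim2
    (F : Type*) [Field F] (hchar : (2 : F) ≠ 0)
    (d D : (Fin 2 → F) →ₗ[F] (Fin 2 → F)) :
    ((∀ u v, d (bracketL2dim2 u v) = bracketL2dim2 (d u) v + bracketL2dim2 u (d v)) ∧
     (∀ u v, D (bracketL2dim2 u v) = bracketL2dim2 (D u) v - bracketL2dim2 (D v) u) ∧
     (∀ u v, bracketL2dim2 u (d v) = bracketL2dim2 u (D v))) ↔
    ∃ a x : F,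
      LinearMap.toMatrix' d = !![a, a; 0, 0] ∧
      LinearMap.toMatrix' D = !![0, x; 0, 0] := by
  constructor
  · rintro ⟨hd, hD, hdD⟩
    have d01 := hd ![1, 0] ![0, 1]
    have d11 := hd ![0, 1] ![0, 1]
    have D01 := hD ![1, 0] ![0, 1]
    have D11 := hD ![0, 1] ![0, 1]
    have c11 := hdD ![0, 1] ![0, 1]
    refine ⟨LinearMap.toMatrix' d 0 0, LinearMap.toMatrix' D 0 1, ?_, ?_⟩ <;>
    · simp only [funext_iff, Fin.forall_fin_two, bracketL2dim2, Pi.add_apply, Pi.sub_apply,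
        apply_eq_toMatrix'_fin_two, cons_val_zero, cons_val_one] at d01 d11 D01 D11 c11
      ext i j
      fin_cases i <;> fin_cases j <;> simp [-LinearMap.toMatrix'_apply] <;> grind
  · rintro ⟨a, x, hd, hD⟩
    refine ⟨fun u v => ?_, fun u v => ?_, fun u v => ?_⟩ <;>
    · ext i
      fin_cases i <;> simp [bracketL2dim2, apply_eq_toMatrix'_fin_two, hd, hD,
        -LinearMap.toMatrix'_apply] <;> ring
end

section
/- Let F be a field with char(F) ≠ 2 and let L₂ = F² with basis {e₁,e₂} and the right Leibniz bracket determined by [e₁,e₂] = e₁ and [e₂,e₂] = e₁ (all other brackets of basis vectors zero). Then every biderivation of L₂ is inner: for every biderivation (d,D) of L₂ there exists u ∈ L₂ such that d = −ad_u and D = Ad_u, where ad_u(y) = [y,u] and Ad_u(y) = [u,y]. -/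
/-- The bracket of the two-dimensional solvable Leibniz algebra `L₂`,
determined by `[e₁,e₂] = [e₂,e₂] = e₁` and bilinearity. -/
def bracketL2 {F : Type*} [Field F] (u v : Fin 2 → F) : Fin 2 → F :=
  ![u 0 * v 1 + u 1 * v 1, 0]

theorem LinearMap.apply_eq_smul_add_smul_fin_two {R M : Type*} [Semiring R] [AddCommMonoid M]
    [Module R M] (f : (Fin 2 → R) →ₗ[R] M) (y : Fin 2 → R) :
    f y = y 0 • f ![1, 0] + y 1 • f ![0, 1] := by
  rw [← map_smul, ← map_smul, ← map_add]
  congr 1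
  ext i
  fin_cases i <;> simp

/-- Every biderivation of the two-dimensional solvable Leibniz algebra `L₂`
is inner: it is of the form `(-ad_u, Ad_u)` for some `u ∈ L₂`. -/
theorem biderivations_L2_inner
    (F : Type*) [Field F] (hchar : (2 : F) ≠ 0)
    (d D : (Fin 2 → F) →ₗ[F] (Fin 2 → F))
    (hd : ∀ u v, d (bracketL2 u v) = bracketL2 (d u) v + bracketL2 u (d v))
    (hD : ∀ u v, D (bracketL2 u v) = bracketL2 (D u) v - bracketL2 (D v) u)
    (hc : ∀ u v, bracketL2 u (d v) = bracketL2 u (D v)) :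
    ∃ u : Fin 2 → F, (∀ y, d y = -bracketL2 y u) ∧ (∀ y, D y = bracketL2 u y) := by
  have hd₁₂ := hd ![1, 0] ![0, 1]
  have hd₂₂ := hd ![0, 1] ![0, 1]
  have hD₂₂ := hD ![0, 1] ![0, 1]
  have hc₂ := congrFun (hc ![1, 0] ![0, 1]) 0
  simp only [bracketL2, Matrix.cons_val_zero, Matrix.cons_val_one, mul_one, one_mul,
    zero_mul, add_zero, zero_add, sub_self] at hd₁₂ hd₂₂ hD₂₂ hc₂
  have h₁₁ : d ![1, 0] 1 = 0 := by simpa using congrFun hd₁₂ 1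
  have h₁₀ := congrFun hd₁₂ 0
  have h₂₀ := congrFun hd₂₂ 0
  simp only [Pi.add_apply, Matrix.cons_val_zero] at h₁₀ h₂₀
  have h₂₁ : d ![0, 1] 1 = 0 := by linear_combination -h₁₀ - h₁₁
  have hD₂₁ : D ![0, 1] 1 = 0 := hc₂.symm.trans h₂₁
  refine ⟨![D ![0, 1] 0 + d ![1, 0] 0, -d ![1, 0] 0], fun y => ?_, fun y => ?_⟩
  · rw [d.apply_eq_smul_add_smul_fin_two y]
    ext i
    fin_cases i
    · simp [bracketL2]
      linear_combination (-y 1) * h₂₀ - 2 * y 1 * h₂₁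
    · simp [bracketL2, h₁₁, h₂₁]
  · rw [D.apply_eq_smul_add_smul_fin_two y, hD₂₂]
    ext i
    fin_cases i
    · simp [bracketL2]
      ring
    · simp [bracketL2, hD₂₁]
end

section
/- Let F be a field with char(F) ≠ 2 and let L₁ = F³ with basis {e₁,e₂,e₃} and the right Leibniz bracket determined by [e₁,e₃] = −2e₁, [e₂,e₂] = e₁, [e₃,e₂] = e₂, [e₂,e₃] = −e₂ (all other brackets of basis vectors zero). Then a pair of linear maps (d,D) on L₁ is a biderivation of L₁ if and only if there exist x, y, a ∈ F such that, with respect to the basis {e₁,e₂,e₃}, d has matrix with rows (2x, y, 0), (0, x, y), (0, 0, 0) and D has matrix with rows (0, −y, a), (0, x, y), (0, 0, 0). -/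
open Matrix

/-- Bracket of `L₁`: `[e₁,e₃] = -2e₁`, `[e₂,e₂] = e₁`, `[e₃,e₂] = -[e₂,e₃] = e₂`. -/
def bracketL1dim3 {F : Type*} [Field F] (u v : Fin 3 → F) : Fin 3 → F :=
  ![-2 * (u 0 * v 2) + u 1 * v 1, u 2 * v 1 - u 1 * v 2, 0]

theorem biderivations_L1dim3
    (F : Type*) [Field F] (hchar : (2 : F) ≠ 0)
    (d D : (Fin 3 → F) →ₗ[F] (Fin 3 → F)) :
    ((∀ u v, d (bracketL1dim3 u v) = bracketL1dim3 (d u) v + bracketL1dim3 u (d v)) ∧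
     (∀ u v, D (bracketL1dim3 u v) = bracketL1dim3 (D u) v - bracketL1dim3 (D v) u) ∧
     (∀ u v, bracketL1dim3 u (d v) = bracketL1dim3 u (D v))) ↔
    ∃ x y a : F,
      LinearMap.toMatrix' d = !![2*x, y, 0; 0, x, y; 0, 0, 0] ∧
      LinearMap.toMatrix' D = !![0, -y, a; 0, x, y; 0, 0, 0] := by
  obtain ⟨M, rfl⟩ := Matrix.toLin'.surjective d
  obtain ⟨N, rfl⟩ := Matrix.toLin'.surjective D
  simp only [LinearMap.toMatrix'_toLin', Matrix.toLin'_apply]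
  constructor
  · rintro ⟨hd, hD, h⟩
    have d22 := hd ![0, 1, 0] ![0, 1, 0]
    have d23 := hd ![0, 1, 0] ![0, 0, 1]
    have d33 := hd ![0, 0, 1] ![0, 0, 1]
    have D22 := hD ![0, 1, 0] ![0, 1, 0]
    have D32 := hD ![0, 0, 1] ![0, 1, 0]
    have h22 := h ![0, 1, 0] ![0, 1, 0]
    have h23 := h ![0, 1, 0] ![0, 0, 1]
    clear hd hD h
    simp [bracketL1dim3, funext_iff, Fin.forall_fin_succ, Matrix.mulVec, dotProduct,
      Fin.sum_univ_succ, hchar] at d22 d23 d33 D22 D32 h22 h23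
    refine ⟨M 1 1, M 0 1, N 0 2, ?_, ?_⟩ <;> ext i j <;> fin_cases i <;> fin_cases j <;>
      simp <;> grind
  · rintro ⟨x, y, a, rfl, rfl⟩
    refine ⟨fun u v => ?_, fun u v => ?_, fun u v => ?_⟩ <;> ext i <;> fin_cases i <;>
      simp [bracketL1dim3, Matrix.mulVec, dotProduct, Fin.sum_univ_succ] <;> ring
end

section
/- Let F be a field with char(F) ≠ 2 and let L₃ = F³ with basis {e₁,e₂,e₃} and the right Leibniz bracket determined by [e₃,e₂] = e₂, [e₂,e₃] = −e₂, [e₃,e₃] = −e₁ (all other brackets of basis vectors zero). Then a pair of linear maps (d,D) on L₃ is a biderivation of L₃ if and only if there exist x, y, z, a ∈ F such that, with respect to the basis {e₁,e₂,e₃}, d has matrix with rows (0, 0, y), (0, x, z), (0, 0, 0) and D has matrix with rows (0, 0, a), (0, x, z), (0, 0, 0). -/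
open Matrix

/-- Bracket of `L₃`: `[e₃,e₂] = -[e₂,e₃] = e₂`, `[e₃,e₃] = -e₁`. -/
def bracketL3 {F : Type*} [Field F] (u v : Fin 3 → F) : Fin 3 → F :=
  ![-(u 2 * v 2), u 2 * v 1 - u 1 * v 2, 0]

theorem biderivations_L3
    (F : Type*) [Field F] (hchar : (2 : F) ≠ 0)
    (d D : (Fin 3 → F) →ₗ[F] (Fin 3 → F)) :
    ((∀ u v, d (bracketL3 u v) = bracketL3 (d u) v + bracketL3 u (d v)) ∧
     (∀ u v, D (bracketL3 u v) = bracketL3 (D u) v - bracketL3 (D v) u) ∧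
     (∀ u v, bracketL3 u (d v) = bracketL3 u (D v))) ↔
    ∃ x y z a : F,
      LinearMap.toMatrix' d = !![0, 0, y; 0, x, z; 0, 0, 0] ∧
      LinearMap.toMatrix' D = !![0, 0, a; 0, x, z; 0, 0, 0] := by
  obtain ⟨A, rfl⟩ := Matrix.toLin'.surjective d
  obtain ⟨B, rfl⟩ := Matrix.toLin'.surjective D
  simp only [LinearMap.toMatrix'_toLin', Matrix.toLin'_apply]
  constructor
  · rintro ⟨hd, hD, hdD⟩
    have hd₃₃ := hd ![0, 0, 1] ![0, 0, 1]
    have hd₃₂ := hd ![0, 0, 1] ![0, 1, 0]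
    have hD₃₃ := hD ![0, 0, 1] ![0, 0, 1]
    have hD₃₂ := hD ![0, 0, 1] ![0, 1, 0]
    have hdD₃₂ := hdD ![0, 0, 1] ![0, 1, 0]
    have hdD₃₃ := hdD ![0, 0, 1] ![0, 0, 1]
    simp [bracketL3, funext_iff, Fin.forall_fin_succ, Matrix.mulVec, dotProduct,
      Fin.sum_univ_succ] at hd₃₃ hd₃₂ hD₃₃ hD₃₂ hdD₃₂ hdD₃₃
    refine ⟨A 1 1, A 0 2, A 1 2, B 0 2, ?_, ?_⟩ <;> ext i j <;> fin_cases i <;>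
      fin_cases j <;> simp <;> grind
  · rintro ⟨x, y, z, a, rfl, rfl⟩
    refine ⟨fun u v => ?_, fun u v => ?_, fun u v => ?_⟩ <;> ext i <;> fin_cases i <;>
      simp [bracketL3, Matrix.mulVec, dotProduct, Fin.sum_univ_succ] <;> ring
end

section
/- Let F be a field with char(F) ≠ 2 and let L₄ = F³ with basis {e₁,e₂,e₃} and the right Leibniz bracket determined by [e₂,e₂] = e₁ and [e₃,e₃] = e₁ (all other brackets of basis vectors zero). Then a pair of linear maps (d,D) on L₄ is a biderivation of L₄ if and only if there exist x, y, z, a, b ∈ F such that, with respect to the basis {e₁,e₂,e₃}, d has matrix with rows (2x, y, z), (0, x, 0), (0, 0, x) and D has matrix with rows (0, a, b), (0, x, 0), (0, 0, x). -/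
open Matrix

/-- Bracket of `L₄`: `[e₂,e₂] = e₁`, `[e₃,e₃] = e₁`. -/
def bracketL4 {F : Type*} [Field F] (u v : Fin 3 → F) : Fin 3 → F :=
  ![u 1 * v 1 + u 2 * v 2, 0, 0]

theorem biderivations_L4
    (F : Type*) [Field F] (hchar : (2 : F) ≠ 0)
    (d D : (Fin 3 → F) →ₗ[F] (Fin 3 → F)) :
    ((∀ u v, d (bracketL4 u v) = bracketL4 (d u) v + bracketL4 u (d v)) ∧
     (∀ u v, D (bracketL4 u v) = bracketL4 (D u) v - bracketL4 (D v) u) ∧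
     (∀ u v, bracketL4 u (d v) = bracketL4 u (D v))) ↔
    ∃ x y z a b : F,
      LinearMap.toMatrix' d = !![2*x, y, z; 0, x, 0; 0, 0, x] ∧
      LinearMap.toMatrix' D = !![0, a, b; 0, x, 0; 0, 0, x] := by
  have apply_eq (T : (Fin 3 → F) →ₗ[F] (Fin 3 → F)) (u : Fin 3 → F) (i : Fin 3) :
      T u i = LinearMap.toMatrix' T i 0 * u 0 + LinearMap.toMatrix' T i 1 * u 1
        + LinearMap.toMatrix' T i 2 * u 2 := by
    rw [← LinearMap.toMatrix'_mulVec T u]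
    simp [Matrix.mulVec, dotProduct, Fin.sum_univ_three]
  simp only [funext_iff, Pi.add_apply, Pi.sub_apply, bracketL4, apply_eq]
  generalize LinearMap.toMatrix' d = P
  generalize LinearMap.toMatrix' D = Q
  constructor
  · rintro ⟨hd, hD, hb⟩
    have hd11 := hd ![0, 1, 0] ![0, 1, 0]
    have hd12 := hd ![0, 1, 0] ![0, 0, 1] 0
    have hd22 := hd ![0, 0, 1] ![0, 0, 1] 0
    have hD11 := hD ![0, 1, 0] ![0, 1, 0]
    have hD12 := hD ![0, 1, 0] ![0, 0, 1] 0
    have hb1 := fun j => hb ![0, 1, 0] (Pi.single j 1) 0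
    have hb2 := fun j => hb ![0, 0, 1] (Pi.single j 1) 0
    simp [Fin.forall_fin_succ] at hd11 hd12 hd22 hD11 hD12 hb1 hb2
    have h12 : P 1 2 = 0 := by
      apply (mul_eq_zero.mp (_ : (2 : F) * P 1 2 = 0)).resolve_left hchar
      grind
    have h22 : P 2 2 = P 1 1 := by
      apply mul_left_cancel₀ hchar
      grind
    refine ⟨P 1 1, P 0 1, P 0 2, Q 0 1, Q 0 2, ?_, ?_⟩ <;> ext i j <;>
      fin_cases i <;> fin_cases j <;> simp <;> grind
  · rintro ⟨x, y, z, a, b, rfl, rfl⟩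
    refine ⟨fun u v i => ?_, fun u v i => ?_, fun u v i => ?_⟩ <;> fin_cases i <;> simp <;> ring
end

section
/- Let F be a field with char(F) ≠ 2, let α ∈ F with α ≠ 0, set γ = (4α−1)/(2α), and let L₇(α) = F³ with basis {e₁,e₂,e₃} and the right Leibniz bracket determined by [e₂,e₂] = e₁, [e₂,e₃] = e₁, [e₃,e₃] = α e₁ (all other brackets of basis vectors zero). Then a pair of linear maps (d,D) on L₇(α) is a biderivation of L₇(α) if and only if there exist x, y, z, a, b ∈ F such that, with respect to the basis {e₁,e₂,e₃}, d has matrix with rows (γx, y, z), (0, x, x/2), (0, −x/(2α), (γ−1)x) and D has matrix with rows (0, a, b), (0, x, x/2), (0, −x/(2α), (γ−1)x). -/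
open Matrix

/-- Bracket of `L₇(α)`: `[e₂,e₂] = [e₂,e₃] = e₁`, `[e₃,e₃] = α e₁`. -/
def bracketL7alpha {F : Type*} [Field F] (α : F) (u v : Fin 3 → F) : Fin 3 → F :=
  ![u 1 * v 1 + u 1 * v 2 + α * (u 2 * v 2), 0, 0]

theorem biderivations_L7alpha
    (F : Type*) [Field F] (hchar : (2 : F) ≠ 0)
    (α : F) (hα : α ≠ 0)
    (d D : (Fin 3 → F) →ₗ[F] (Fin 3 → F)) :
    ((∀ u v, d (bracketL7alpha α u v) = bracketL7alpha α (d u) v + bracketL7alpha α u (d v)) ∧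
     (∀ u v, D (bracketL7alpha α u v) = bracketL7alpha α (D u) v - bracketL7alpha α (D v) u) ∧
     (∀ u v, bracketL7alpha α u (d v) = bracketL7alpha α u (D v))) ↔
    ∃ x y z a b : F,
      LinearMap.toMatrix' d = !![((4*α-1)/(2*α))*x, y, z; 0, x, x/2; 0, -(x/(2*α)), ((4*α-1)/(2*α)-1)*x] ∧
      LinearMap.toMatrix' D = !![0, a, b; 0, x, x/2; 0, -(x/(2*α)), ((4*α-1)/(2*α)-1)*x] := by
  constructor
  · rintro ⟨hd, hD, hdD⟩
    have d22 := congrFun (hd (Pi.single 1 1) (Pi.single 1 1))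
    have d23 := congrFun (hd (Pi.single 1 1) (Pi.single 2 1)) 0
    have d32 := congrFun (hd (Pi.single 2 1) (Pi.single 1 1)) 0
    have D22 := congrFun (hD (Pi.single 1 1) (Pi.single 1 1))
    have D23 := congrFun (hD (Pi.single 1 1) (Pi.single 2 1)) 0
    have row2 := fun j => congrFun (hdD (Pi.single 1 1) (Pi.single j 1)) 0
    have row3 := fun j => congrFun (hdD (Pi.single 2 1) (Pi.single j 1)) 0
    have e1 : (![1, 0, 0] : Fin 3 → F) = Pi.single 0 1 := by
      ext i; fin_cases i <;> simp
    have e0 : (![0, 0, 0] : Fin 3 → F) = 0 := by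
      ext i; fin_cases i <;> simp
    simp [bracketL7alpha, Fin.forall_fin_succ, e1, e0, hα] at d22 d23 d32 D22 D23 row2 row3
    obtain ⟨d11, d21, d31⟩ := d22
    obtain ⟨D11, D21, D31⟩ := D22
    obtain ⟨r0, r1, r2⟩ := row2
    obtain ⟨s0, s1, s2⟩ := row3
    have h32 : d (Pi.single 1 1) 2 = -(d (Pi.single 1 1) 1 / (2 * α)) := by
      field_simp
      grind
    have h23 : d (Pi.single 2 1) 1 = d (Pi.single 1 1) 1 / 2 := by
      field_simp at h32 ⊢
      grind
    refine ⟨d (Pi.single 1 1) 1, d (Pi.single 1 1) 0, d (Pi.single 2 1) 0,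
      D (Pi.single 1 1) 0, D (Pi.single 2 1) 0, ?_, ?_⟩ <;> ext i j <;>
      fin_cases i <;> fin_cases j <;> simp [LinearMap.toMatrix'_apply] <;> grind
  · rintro ⟨x, y, z, a, b, hd, hD⟩
    have hd' : d = Matrix.toLin' _ := (LinearMap.toMatrix'.eq_symm_apply).2 hd
    have hD' : D = Matrix.toLin' _ := (LinearMap.toMatrix'.eq_symm_apply).2 hD
    subst hd' hD'
    refine ⟨fun u v => ?_, fun u v => ?_, fun u v => ?_⟩ <;> ext i <;> fin_cases i <;>
      simp [bracketL7alpha, Matrix.mulVec, dotProduct, Fin.sum_univ_three] <;>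
      field_simp <;> ring
end

section
/- Let F be a field with char(F) ≠ 2 and let L₉ = F³ with basis {e₁,e₂,e₃} and the right Leibniz bracket determined by [e₁,e₃] = e₂ and [e₂,e₃] = e₁ (all other brackets of basis vectors zero). Then a pair of linear maps (d,D) on L₉ is a biderivation of L₉ if and only if there exist x, y, a, b ∈ F such that, with respect to the basis {e₁,e₂,e₃}, d has matrix with rows (x, y, 0), (y, x, 0), (0, 0, 0) and D has matrix with rows (0, 0, a), (0, 0, b), (0, 0, 0). -/
open Matrix

/-- Bracket of `L₉`: `[e₁,e₃] = e₂`, `[e₂,e₃] = e₁`. -/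
def bracketL9 {F : Type*} [Field F] (u v : Fin 3 → F) : Fin 3 → F :=
  ![u 1 * v 2, u 0 * v 2, 0]

theorem biderivations_L9
    (F : Type*) [Field F] (hchar : (2 : F) ≠ 0)
    (d D : (Fin 3 → F) →ₗ[F] (Fin 3 → F)) :
    ((∀ u v, d (bracketL9 u v) = bracketL9 (d u) v + bracketL9 u (d v)) ∧
     (∀ u v, D (bracketL9 u v) = bracketL9 (D u) v - bracketL9 (D v) u) ∧
     (∀ u v, bracketL9 u (d v) = bracketL9 u (D v))) ↔
    ∃ x y a b : F,
      LinearMap.toMatrix' d = !![x, y, 0; y, x, 0; 0, 0, 0] ∧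
      LinearMap.toMatrix' D = !![0, 0, a; 0, 0, b; 0, 0, 0] := by
  obtain ⟨M, rfl⟩ := Matrix.toLin'.surjective d
  obtain ⟨N, rfl⟩ := Matrix.toLin'.surjective D
  simp only [LinearMap.toMatrix'_toLin', Matrix.toLin'_apply]
  constructor
  · rintro ⟨hd, hD, hdD⟩
    have hd₁₃ := hd ![1, 0, 0] ![0, 0, 1]
    have hd₂₃ := hd ![0, 1, 0] ![0, 0, 1]
    have hd₃₃ := hd ![0, 0, 1] ![0, 0, 1]
    have hD₁₃ := hD ![1, 0, 0] ![0, 0, 1]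
    have hD₃₁ := hD ![0, 0, 1] ![1, 0, 0]
    have hD₃₂ := hD ![0, 0, 1] ![0, 1, 0]
    have hdD₁₁ := hdD ![1, 0, 0] ![1, 0, 0]
    have hdD₁₂ := hdD ![1, 0, 0] ![0, 1, 0]
    have hdD₁₃ := hdD ![1, 0, 0] ![0, 0, 1]
    simp [funext_iff, Fin.forall_fin_succ, bracketL9, Matrix.mulVec, dotProduct,
      Fin.sum_univ_three] at hd₁₃ hd₂₃ hd₃₃ hD₁₃ hD₃₁ hD₃₂ hdD₁₁ hdD₁₂ hdD₁₃
    have hM₃₃ : M 2 2 = 0 := by grind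
    refine ⟨M 0 0, M 0 1, N 0 2, N 1 2, ?_, ?_⟩ <;>
      ext i j <;> fin_cases i <;> fin_cases j <;> simp <;> grind
  · rintro ⟨x, y, a, b, rfl, rfl⟩
    refine ⟨fun u v => ?_, fun u v => ?_, fun u v => ?_⟩ <;>
      ext i <;> fin_cases i <;>
      simp [bracketL9, Matrix.mulVec, dotProduct, Fin.sum_univ_three] <;> ring
end

section
/- Let F be a field with char(F) ≠ 2 and let L₁₀ = F³ with basis {e₁,e₂,e₃} and the right Leibniz bracket determined by [e₁,e₃] = e₂ and [e₂,e₃] = −e₁ (all other brackets of basis vectors zero). Then a pair of linear maps (d,D) on L₁₀ is a biderivation of L₁₀ if and only if there exist x, y, a, b ∈ F such that, with respect to the basis {e₁,e₂,e₃}, d has matrix with rows (x, −y, 0), (y, x, 0), (0, 0, 0) and D has matrix with rows (0, 0, a), (0, 0, b), (0, 0, 0). -/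
open Matrix

/-- Bracket of `L₁₀`: `[e₁,e₃] = e₂`, `[e₂,e₃] = -e₁`. -/
def bracketL10 {F : Type*} [Field F] (u v : Fin 3 → F) : Fin 3 → F :=
  ![-(u 1 * v 2), u 0 * v 2, 0]

theorem biderivations_L10
    (F : Type*) [Field F] (hchar : (2 : F) ≠ 0)
    (d D : (Fin 3 → F) →ₗ[F] (Fin 3 → F)) :
    ((∀ u v, d (bracketL10 u v) = bracketL10 (d u) v + bracketL10 u (d v)) ∧
     (∀ u v, D (bracketL10 u v) = bracketL10 (D u) v - bracketL10 (D v) u) ∧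
     (∀ u v, bracketL10 u (d v) = bracketL10 u (D v))) ↔
    ∃ x y a b : F,
      LinearMap.toMatrix' d = !![x, -y, 0; y, x, 0; 0, 0, 0] ∧
      LinearMap.toMatrix' D = !![0, 0, a; 0, 0, b; 0, 0, 0] := by
  obtain ⟨A, rfl⟩ := Matrix.toLin'.surjective d
  obtain ⟨B, rfl⟩ := Matrix.toLin'.surjective D
  simp only [LinearMap.toMatrix'_toLin', Matrix.toLin'_apply]
  constructor
  · rintro ⟨hd, hD, hdD⟩
    have d13 := hd ![1, 0, 0] ![0, 0, 1]
    have d23 := hd ![0, 1, 0] ![0, 0, 1]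
    have d33 := hd ![0, 0, 1] ![0, 0, 1]
    have D31 := hD ![0, 0, 1] ![1, 0, 0]
    have D32 := hD ![0, 0, 1] ![0, 1, 0]
    have m1 := hdD ![1, 0, 0] ![1, 0, 0]
    have m2 := hdD ![1, 0, 0] ![0, 1, 0]
    have m3 := hdD ![1, 0, 0] ![0, 0, 1]
    simp [funext_iff, Fin.forall_fin_succ, bracketL10, Matrix.mulVec, dotProduct,
      Fin.sum_univ_three] at d13 d23 d33 D31 D32 m1 m2 m3
    have r : A 2 2 = 0 := by
      have : 2 * A 2 2 = 0 := by grind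
      exact (mul_eq_zero.mp this).resolve_left hchar
    refine ⟨A 0 0, A 1 0, B 0 2, B 1 2, ?_, ?_⟩ <;> ext i j <;> fin_cases i <;> fin_cases j <;>
      simp <;> grind
  · rintro ⟨x, y, a, b, rfl, rfl⟩
    refine ⟨fun u v => ?_, fun u v => ?_, fun u v => ?_⟩ <;> ext i <;> fin_cases i <;>
      simp [bracketL10, Matrix.mulVec, dotProduct, Fin.sum_univ_three] <;> ring
end

section
/- Let F be a field with char(F) ≠ 2, let α ∈ F with α ≠ 0, and let L₁₂(α) = F³ with basis {e₁,e₂,e₃} and the right Leibniz bracket determined by [e₁,e₃] = e₂ and [e₂,e₃] = α e₁ + e₂ (all other brackets of basis vectors zero). Then a pair of linear maps (d,D) on L₁₂(α) is a biderivation of L₁₂(α) if and only if there exist x, y, a, b ∈ F such that, with respect to the basis {e₁,e₂,e₃}, d has matrix with rows (x, αy, 0), (y, x+y, 0), (0, 0, 0) and D has matrix with rows (0, 0, a), (0, 0, b), (0, 0, 0). -/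
open Matrix

/-- Bracket of `L₁₂(α)`: `[e₁,e₃] = e₂`, `[e₂,e₃] = α e₁ + e₂`. -/
def bracketL12alpha {F : Type*} [Field F] (α : F) (u v : Fin 3 → F) : Fin 3 → F :=
  ![α * (u 1 * v 2), u 0 * v 2 + u 1 * v 2, 0]

theorem biderivations_L12alpha
    (F : Type*) [Field F] (hchar : (2 : F) ≠ 0)
    (α : F) (hα : α ≠ 0)
    (d D : (Fin 3 → F) →ₗ[F] (Fin 3 → F)) :
    ((∀ u v, d (bracketL12alpha α u v) = bracketL12alpha α (d u) v + bracketL12alpha α u (d v)) ∧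
     (∀ u v, D (bracketL12alpha α u v) = bracketL12alpha α (D u) v - bracketL12alpha α (D v) u) ∧
     (∀ u v, bracketL12alpha α u (d v) = bracketL12alpha α u (D v))) ↔
    ∃ x y a b : F,
      LinearMap.toMatrix' d = !![x, α*y, 0; y, x+y, 0; 0, 0, 0] ∧
      LinearMap.toMatrix' D = !![0, 0, a; 0, 0, b; 0, 0, 0] := by
  obtain ⟨A, rfl⟩ := Matrix.toLin'.surjective d
  obtain ⟨B, rfl⟩ := Matrix.toLin'.surjective D
  simp only [LinearMap.toMatrix'_toLin', Matrix.toLin'_apply]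
  constructor
  · rintro ⟨hd, hD, hdD⟩
    have d11 := hd ![1, 0, 0] ![1, 0, 0]
    have d12 := hd ![1, 0, 0] ![0, 1, 0]
    have d13 := hd ![1, 0, 0] ![0, 0, 1]
    have d23 := hd ![0, 1, 0] ![0, 0, 1]
    have d33 := hd ![0, 0, 1] ![0, 0, 1]
    have D31 := hD ![0, 0, 1] ![1, 0, 0]
    have D32 := hD ![0, 0, 1] ![0, 1, 0]
    have c1 := hdD ![1, 0, 0] ![1, 0, 0]
    have c2 := hdD ![1, 0, 0] ![0, 1, 0]
    have c3 := hdD ![1, 0, 0] ![0, 0, 1]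
    simp [bracketL12alpha, funext_iff, Fin.forall_fin_succ, Matrix.mulVec, dotProduct,
      Fin.sum_univ_three, hα] at d11 d12 d13 d23 d33 D31 D32 c1 c2 c3
    refine ⟨A 0 0, A 1 0, B 0 2, B 1 2, ?_, ?_⟩ <;> ext i j <;> fin_cases i <;> fin_cases j <;>
      simp <;> grind
  · rintro ⟨x, y, a, b, rfl, rfl⟩
    refine ⟨fun u v => ?_, fun u v => ?_, fun u v => ?_⟩ <;> ext i <;> fin_cases i <;>
      simp [bracketL12alpha, Matrix.mulVec, dotProduct, Fin.sum_univ_three] <;> ring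
end

section
/- Let F be a field with char(F) ≠ 2 and let L₁₄ = F³ with basis {e₁,e₂,e₃} and the right Leibniz bracket determined by [e₁,e₃] = e₂ and [e₃,e₃] = e₁ (all other brackets of basis vectors zero). Then a pair of linear maps (d,D) on L₁₄ is a biderivation of L₁₄ if and only if there exist x, y, z, a, b ∈ F such that, with respect to the basis {e₁,e₂,e₃}, d has matrix with rows (2x, 0, y), (y, 3x, z), (0, 0, x) and D has matrix with rows (0, 0, a), (0, 0, b), (0, 0, x). -/
open Matrix

/-- Bracket of `L₁₄`: `[e₁,e₃] = e₂`, `[e₃,e₃] = e₁`. -/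
def bracketL14 {F : Type*} [Field F] (u v : Fin 3 → F) : Fin 3 → F :=
  ![u 2 * v 2, u 0 * v 2, 0]

theorem biderivations_L14
    (F : Type*) [Field F] (hchar : (2 : F) ≠ 0)
    (d D : (Fin 3 → F) →ₗ[F] (Fin 3 → F)) :
    ((∀ u v, d (bracketL14 u v) = bracketL14 (d u) v + bracketL14 u (d v)) ∧
     (∀ u v, D (bracketL14 u v) = bracketL14 (D u) v - bracketL14 (D v) u) ∧
     (∀ u v, bracketL14 u (d v) = bracketL14 u (D v))) ↔
    ∃ x y z a b : F,
      LinearMap.toMatrix' d = !![2*x, 0, y; y, 3*x, z; 0, 0, x] ∧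
      LinearMap.toMatrix' D = !![0, 0, a; 0, 0, b; 0, 0, x] := by
  obtain ⟨M, rfl⟩ := Matrix.toLin'.surjective d
  obtain ⟨N, rfl⟩ := Matrix.toLin'.surjective D
  simp only [LinearMap.toMatrix'_toLin', Matrix.toLin'_apply]
  constructor
  · rintro ⟨hd, hD, hdD⟩
    have hd₃₃ := hd ![0, 0, 1] ![0, 0, 1]
    have hd₁₃ := hd ![1, 0, 0] ![0, 0, 1]
    have hD₃₃ := hD ![0, 0, 1] ![0, 0, 1]
    have hD₁₃ := hD ![1, 0, 0] ![0, 0, 1]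
    have hdD₃₃ := hdD ![0, 0, 1] ![0, 0, 1]
    simp [bracketL14, funext_iff, Fin.forall_fin_succ, Matrix.mulVec, dotProduct,
      Fin.sum_univ_three] at hd₃₃ hd₁₃ hD₃₃ hD₁₃ hdD₃₃
    refine ⟨M 2 2, M 0 2, M 1 2, N 0 2, N 1 2, ?_, ?_⟩ <;>
    · ext i j
      fin_cases i <;> fin_cases j <;> simp <;> grind
  · rintro ⟨x, y, z, a, b, rfl, rfl⟩
    refine ⟨fun u v => ?_, fun u v => ?_, fun u v => ?_⟩ <;>
    · ext i
      fin_cases i <;>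
        simp [bracketL14, Matrix.mulVec, dotProduct, Fin.sum_univ_three] <;> ring
end

section
/- Let F be a field with char(F) ≠ 2 and let L₁₅ = F³ with basis {e₁,e₂,e₃} and the right Leibniz bracket determined by [e₁,e₃] = e₁ + e₂ and [e₃,e₃] = e₁ (all other brackets of basis vectors zero). Then a pair of linear maps (d,D) on L₁₅ is a biderivation of L₁₅ if and only if there exist x, y, a, b ∈ F such that, with respect to the basis {e₁,e₂,e₃}, d has matrix with rows (x, 0, x), (x, 0, y), (0, 0, 0) and D has matrix with rows (0, 0, a), (0, 0, b), (0, 0, 0). -/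
open Matrix

/-- Bracket of `L₁₅`: `[e₁,e₃] = e₁ + e₂`, `[e₃,e₃] = e₁`. -/
def bracketL15 {F : Type*} [Field F] (u v : Fin 3 → F) : Fin 3 → F :=
  ![u 0 * v 2 + u 2 * v 2, u 0 * v 2, 0]

theorem biderivations_L15
    (F : Type*) [Field F] (hchar : (2 : F) ≠ 0)
    (d D : (Fin 3 → F) →ₗ[F] (Fin 3 → F)) :
    ((∀ u v, d (bracketL15 u v) = bracketL15 (d u) v + bracketL15 u (d v)) ∧
     (∀ u v, D (bracketL15 u v) = bracketL15 (D u) v - bracketL15 (D v) u) ∧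
     (∀ u v, bracketL15 u (d v) = bracketL15 u (D v))) ↔
    ∃ x y a b : F,
      LinearMap.toMatrix' d = !![x, 0, x; x, 0, y; 0, 0, 0] ∧
      LinearMap.toMatrix' D = !![0, 0, a; 0, 0, b; 0, 0, 0] := by
  obtain ⟨A, rfl⟩ := Matrix.toLin'.surjective d
  obtain ⟨B, rfl⟩ := Matrix.toLin'.surjective D
  simp only [LinearMap.toMatrix'_toLin', Matrix.toLin'_apply]
  constructor
  · rintro ⟨hd, hD, hdD⟩
    have d13 := hd ![1, 0, 0] ![0, 0, 1]
    have d33 := hd ![0, 0, 1] ![0, 0, 1]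
    have d11 := hd ![1, 0, 0] ![1, 0, 0]
    have d12 := hd ![1, 0, 0] ![0, 1, 0]
    have d23 := hd ![0, 1, 0] ![0, 0, 1]
    have D13 := hD ![1, 0, 0] ![0, 0, 1]
    have D33 := hD ![0, 0, 1] ![0, 0, 1]
    have dD13 := hdD ![1, 0, 0] ![0, 0, 1]
    simp [funext_iff, Fin.forall_fin_succ, bracketL15, Matrix.mulVec, dotProduct,
      Fin.sum_univ_three] at d13 d33 d11 d12 d23 D13 D33 dD13
    refine ⟨A 0 0, A 1 2, B 0 2, B 1 2, ?_, ?_⟩ <;> ext i j <;> fin_cases i <;> fin_cases j <;>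
      simp <;> grind
  · rintro ⟨x, y, a, b, rfl, rfl⟩
    refine ⟨fun u v => ?_, fun u v => ?_, fun u v => ?_⟩ <;> ext i <;> fin_cases i <;>
      simp [bracketL15, Matrix.mulVec, dotProduct, Fin.sum_univ_three] <;> ring
end
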